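/- arXiv:2309.01197 — 2 statements merged into one kernel-verified Lean document; each statement's English description precedes it below -/
import Mathlib

section
/- Let v : Ω̄×[0,T] → ℝ² be smooth. Then ‖∂_t∂₁Dv(t)‖_{L^∞(Ω)} ≤ C E(t,v)^{1/2} for every t ∈ [0,T], with C depending only on Ω, C₁, C₂. -/
open MeasureTheory Real Filter

noncomputable section

/-- The reference domain `Ω = 𝕋 × (0,1)`, realized as the fundamental square `(0,1) × (0,1)`. -/
def Oset : Set (ℝ × ℝ) := Set.Ioo (0:ℝ) 1 ×ˢ Set.Ioo (0:ℝ) 1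

/-- The vacuum boundary `Γ = 𝕋 × {0,1}`. -/
def Gset : Set (ℝ × ℝ) := {x : ℝ × ℝ | x.2 = 0 ∨ x.2 = 1}

/-- Distance to the boundary `Γ`. -/
def distG (x : ℝ × ℝ) : ℝ := min x.2 (1 - x.2)

variable {F : Type*} [NormedAddCommGroup F] [NormedSpace ℝ F]

/-- Horizontal partial derivative `∂₁`. -/
def pd1 (f : ℝ × ℝ → F) : ℝ × ℝ → F := fun x => fderiv ℝ f x (1, 0)

/-- Vertical (normal) partial derivative `∂₂`. -/
def pd2 (f : ℝ × ℝ → F) : ℝ × ℝ → F := fun x => fderiv ℝ f x (0, 1)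

/-- Time derivative `∂ₜ`. -/
def pdt (v : ℝ → ℝ × ℝ → F) : ℝ → ℝ × ℝ → F := fun t x => deriv (fun s => v s x) t

/-- `|Df|²` at a point. -/
def gradSq (f : ℝ × ℝ → F) (x : ℝ × ℝ) : ℝ := ‖pd1 f x‖ ^ 2 + ‖pd2 f x‖ ^ 2

/-- 1-periodicity in the horizontal variable (functions on the torus `𝕋 × (0,1)`). -/
def Per (f : ℝ × ℝ → F) : Prop := ∀ x : ℝ × ℝ, f (x.1 + 1, x.2) = f x

/-- Smoothness. -/
def SmoothFn (f : ℝ × ℝ → F) : Prop := ∀ n : ℕ, ContDiff ℝ n f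

/-- Joint smoothness of a time dependent family. -/
def SmoothT (v : ℝ → ℝ × ℝ → F) : Prop :=
  ∀ n : ℕ, ContDiff ℝ n (fun p : ℝ × (ℝ × ℝ) => v p.1 p.2)

def PerT (v : ℝ → ℝ × ℝ → F) : Prop := ∀ t : ℝ, Per (v t)

/-- Admissible initial depth profile: smooth, periodic, vanishing on `Γ` and
comparable to the distance to the boundary. -/
def IsDensity (C₁ C₂ : ℝ) (ρ₀ : ℝ × ℝ → ℝ) : Prop :=
  SmoothFn ρ₀ ∧ Per ρ₀ ∧ (∀ x ∈ Gset, ρ₀ x = 0) ∧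
    ∀ x ∈ Oset, C₁ * distG x ≤ ρ₀ x ∧ ρ₀ x ≤ C₂ * distG x

/-- The higher-order energy functional `E(t,v)`. -/
def energy (ρ₀ : ℝ × ℝ → ℝ) (v : ℝ → ℝ × ℝ → ℝ × ℝ) (t : ℝ) : ℝ :=
  (∑ l₀ ∈ Finset.range 5, ∫ x in Oset, ρ₀ x * ‖(pdt^[l₀] v) t x‖ ^ 2)
    + (∑ l₀ ∈ Finset.range 4, ∑ l₁ ∈ Finset.range (7 - 2 * l₀),
        ∫ x in Oset, ρ₀ x *
          (gradSq (pd1^[l₁] ((pdt^[l₀] v) t)) x + gradSq (pd1^[l₁ + 1] ((pdt^[l₀] v) t)) x))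
    + ∑ l₀ ∈ Finset.range 4, ∑ l₁ ∈ Finset.range (7 - 2 * l₀),
        ∑ l₂ ∈ Finset.Icc 2 (8 - 2 * l₀ - l₁),
          ∫ x in Oset, ρ₀ x ^ l₂ * ‖(pd1^[l₁] (pd2^[l₂] ((pdt^[l₀] v) t))) x‖ ^ 2

/-- The Lagrangian flow map `η(x,t) = x + ∫₀ᵗ v(x,s) ds`. -/
def flowMap (v : ℝ → ℝ × ℝ → ℝ × ℝ) (t : ℝ) (x : ℝ × ℝ) : ℝ × ℝ :=
  x + ∫ s in (0:ℝ)..t, v s x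

/-- The (squared-sum) Sobolev `H^k(Ω)` norm. -/
def sobolevNorm (k : ℕ) (f : ℝ × ℝ → F) : ℝ :=
  Real.sqrt (∑ θ ∈ Finset.range (k + 1), ∫ x in Oset, ‖iteratedFDeriv ℝ θ f x‖ ^ 2)

/-- `sup_{0 ≤ s ≤ t} E(s,v)^{1/2}`. -/
def supEn (ρ₀ : ℝ × ℝ → ℝ) (v : ℝ → ℝ × ℝ → ℝ × ℝ) (t : ℝ) : ℝ :=
  ⨆ s : Set.Icc (0:ℝ) t, Real.sqrt (energy ρ₀ v ↑s)

/-- Weighted `L²(Ω)` norm `‖ρ₀^p ∂₁^{l₁} D^k f‖_{L²(Ω)}`. -/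
def wL2 (ρ₀ : ℝ × ℝ → ℝ) (p k l₁ : ℕ) (f : ℝ × ℝ → F) : ℝ :=
  Real.sqrt (∫ x in Oset, (ρ₀ x ^ p * ‖iteratedFDeriv ℝ k (pd1^[l₁] f) x‖) ^ 2)

/-- Weighted `L^∞(Ω)` norm `‖ρ₀^p ∂₁^{l₁} D^k f‖_{L^∞(Ω)}`. -/
def wSup (ρ₀ : ℝ × ℝ → ℝ) (p k l₁ : ℕ) (f : ℝ × ℝ → F) : ℝ :=
  ⨆ x : Oset, ρ₀ (x : ℝ × ℝ) ^ p * ‖iteratedFDeriv ℝ k (pd1^[l₁] f) (x : ℝ × ℝ)‖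

def pick (i : Fin 2) (w : ℝ × ℝ) : ℝ := if i = 0 then w.1 else w.2

def evec (k : Fin 2) : ℝ × ℝ := if k = 0 then (1, 0) else (0, 1)

def pdk (k : Fin 2) (f : ℝ × ℝ → ℝ) : ℝ × ℝ → ℝ := fun x => fderiv ℝ f x (evec k)

/-- The cofactor matrix `a` of `Dη`, `a = [[∂₂η², −∂₂η¹], [−∂₁η², ∂₁η¹]]`,
indexed so that `cof η x i k = a_i^k`. -/
def cof (η : ℝ × ℝ → ℝ × ℝ) (x : ℝ × ℝ) (i k : Fin 2) : ℝ :=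
  if i = 0 then
    (if k = 0 then pd2 (fun y => (η y).2) x else -pd1 (fun y => (η y).2) x)
  else
    (if k = 0 then -pd2 (fun y => (η y).1) x else pd1 (fun y => (η y).1) x)

/-- The Jacobian determinant `J = det Dη`. -/
def jac (η : ℝ × ℝ → ℝ × ℝ) (x : ℝ × ℝ) : ℝ :=
  pd1 (fun y => (η y).1) x * pd2 (fun y => (η y).2) x
    - pd2 (fun y => (η y).1) x * pd1 (fun y => (η y).2) x

/-- `b^{kj} = a_l^k a_l^j`. -/
def bmat (η : ℝ × ℝ → ℝ × ℝ) (x : ℝ × ℝ) (k j : Fin 2) : ℝ :=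
  ∑ l : Fin 2, cof η x l k * cof η x l j

/-- `(v,η)` is a (classical) solution of the Lagrangian system
`ρ₀ ∂ₜ v^i + (ρ₀² J⁻² a_i^k),_k = (ρ₀ J⁻² b^{kj} v^i,_j),_k` in `Ω × (0,T]`. -/
def IsLagSol (ρ₀ : ℝ × ℝ → ℝ) (v : ℝ → ℝ × ℝ → ℝ × ℝ) (T : ℝ) : Prop :=
  ∀ t : ℝ, 0 < t → t ≤ T → ∀ x ∈ Oset, ∀ i : Fin 2,
    ρ₀ x * pick i (pdt v t x)
        + ∑ k : Fin 2, pdk k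
            (fun y => ρ₀ y ^ 2 * jac (flowMap v t) y ^ (-2 : ℤ) * cof (flowMap v t) y i k) x
      = ∑ k : Fin 2, pdk k
          (fun y => ρ₀ y * jac (flowMap v t) y ^ (-2 : ℤ) *
            ∑ j : Fin 2, bmat (flowMap v t) y k j * pdk j (fun z => pick i (v t z)) y) x

/-- The a priori assumption: `sup_{0≤t≤T} E(t,v) ≤ M₁`,
`T ∈ (0, 1/(20c₁c₂√M₁ + 10c₁²c₂²M₁)] ∩ (0,1)`, where `c₁, c₂` are the constants of the
embedding inequalities, so that in particular `‖Dv‖_{L^∞} ≤ c₁c₂ E^{1/2}`. -/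
def Apriori (ρ₀ : ℝ × ℝ → ℝ) (v : ℝ → ℝ × ℝ → ℝ × ℝ) (T M₁ c₁ c₂ : ℝ) : Prop :=
  0 < c₁ ∧ 0 < c₂ ∧ 0 ≤ M₁ ∧ 0 < T ∧ T ≤ 1 ∧
    T ≤ 1 / (20 * c₁ * c₂ * Real.sqrt M₁ + 10 * c₁ ^ 2 * c₂ ^ 2 * M₁) ∧
    (∀ t ∈ Set.Icc (0:ℝ) T, energy ρ₀ v t ≤ M₁) ∧
    ∀ t ∈ Set.Icc (0:ℝ) T, ∀ x ∈ Oset,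
      ‖fderiv ℝ (v t) x‖ ≤ c₁ * c₂ * Real.sqrt (energy ρ₀ v t)

/-- Smooth test functions compactly supported in `Ω`. -/
def CinfTest (φ : ℝ × ℝ → ℝ) : Prop :=
  (∀ n : ℕ, ContDiff ℝ n φ) ∧ HasCompactSupport φ ∧ tsupport φ ⊆ Oset

/-- `g` is the weak directional derivative of `u` in direction `e` on `Ω`. -/
def WeakPD (e : ℝ × ℝ) (u g : ℝ × ℝ → ℝ) : Prop :=
  ∀ φ : ℝ × ℝ → ℝ, CinfTest φ →
    ∫ x in Oset, u x * fderiv ℝ φ x e = -∫ x in Oset, g x * φ x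

/-- Membership in the weighted space `H¹_{ρ₀}(Ω)`, with weak gradient `Dw`. -/
def InH1w (ρ₀ : ℝ × ℝ → ℝ) (w : ℝ × ℝ → ℝ) (Dw : ℝ × ℝ → ℝ × ℝ) : Prop :=
  AEStronglyMeasurable w (volume.restrict Oset) ∧
    AEStronglyMeasurable Dw (volume.restrict Oset) ∧
    IntegrableOn (fun x => ρ₀ x * (w x) ^ 2) Oset ∧
    IntegrableOn (fun x => ρ₀ x * ‖Dw x‖ ^ 2) Oset ∧
    WeakPD (1, 0) w (fun x => (Dw x).1) ∧ WeakPD (0, 1) w (fun x => (Dw x).2)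

/-- The bilinear form `B[w,φ]_μ = ∫_Ω ρ₀ (Dw·Dφ + wφ) dx`. -/
def Bform (ρ₀ : ℝ × ℝ → ℝ) (w : ℝ × ℝ → ℝ) (Dw : ℝ × ℝ → ℝ × ℝ)
    (φ : ℝ × ℝ → ℝ) (Dφ : ℝ × ℝ → ℝ × ℝ) : ℝ :=
  ∫ x in Oset, ρ₀ x * ((Dw x).1 * (Dφ x).1 + (Dw x).2 * (Dφ x).2 + w x * φ x)

open scoped ContDiff

/-! ### One-dimensional inequalities -/

lemma aux_hardy1 (h h' : ℝ → ℝ) (hd : ∀ x, HasDerivAt h (h' x) x) (hc : Continuous h') (m : ℕ) :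
    ∫ x in (0:ℝ)..1, (x * (1 - x)) ^ m * (h x) ^ 2 ≤
      ∫ x in (0:ℝ)..1, (12 * ((x * (1 - x)) ^ (m + 1) * (h x) ^ 2)
        + 4 * ((x * (1 - x)) ^ (m + 2) * (h' x) ^ 2)) := by
  have hcont : Continuous h := continuous_iff_continuousAt.2 fun x => (hd x).continuousAt
  set G : ℝ → ℝ := fun x =>
    ((m + 1 : ℕ) : ℝ) * (x * (1 - x)) ^ m * (1 - 2 * x) ^ 2 * (h x) ^ 2
      - 2 * (x * (1 - x)) ^ (m + 1) * (h x) ^ 2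
      + (x * (1 - x)) ^ (m + 1) * (1 - 2 * x) * (2 * h x * h' x) with hG
  have hGc : Continuous G := by fun_prop
  have hder : ∀ x, HasDerivAt (fun y => (y * (1 - y)) ^ (m + 1) * (1 - 2 * y) * (h y) ^ 2) (G x) x := by
    intro x
    have h1 : HasDerivAt (fun y : ℝ => y * (1 - y)) (1 - 2 * x) x := by
      have := (hasDerivAt_id x).mul ((hasDerivAt_id x).const_sub 1)
      exact this.congr_deriv (by simp; ring)
    have h2 : HasDerivAt (fun y : ℝ => 1 - 2 * y) (-2) x := by
      have := ((hasDerivAt_id x).const_mul 2).const_sub 1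
      exact this.congr_deriv (by simp)
    have h3 := ((h1.fun_pow (m + 1)).mul h2).mul ((hd x).fun_pow 2)
    exact h3.congr_deriv (by simp [hG]; ring)
  have hint : ∫ x in (0:ℝ)..1, G x = 0 := by
    rw [intervalIntegral.integral_eq_sub_of_hasDerivAt (fun x _ => hder x)
      (hGc.intervalIntegrable _ _)]
    simp
  have key : ∫ x in (0:ℝ)..1, (x * (1 - x)) ^ m * (h x) ^ 2 ≤
      ∫ x in (0:ℝ)..1, ((12 * ((x * (1 - x)) ^ (m + 1) * (h x) ^ 2)
        + 4 * ((x * (1 - x)) ^ (m + 2) * (h' x) ^ 2)) + 2 * G x) := by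
    apply intervalIntegral.integral_mono_on zero_le_one
    · exact (by fun_prop : Continuous _).intervalIntegrable _ _
    · exact (by fun_prop : Continuous _).intervalIntegrable _ _
    · intro x hx
      have hq : 0 ≤ x * (1 - x) := mul_nonneg hx.1 (by linarith [hx.2])
      have hqm : 0 ≤ (x * (1 - x)) ^ m := pow_nonneg hq m
      have hm : (0:ℝ) ≤ m := Nat.cast_nonneg m
      have e : ((12 * ((x * (1 - x)) ^ (m + 1) * (h x) ^ 2)
        + 4 * ((x * (1 - x)) ^ (m + 2) * (h' x) ^ 2)) + 2 * G x)
          - (x * (1 - x)) ^ m * (h x) ^ 2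
          = (x * (1 - x)) ^ m * (((1 - 2 * x) * h x + 2 * (x * (1 - x)) * h' x) ^ 2
            + 4 * (x * (1 - x)) * (h x) ^ 2 + 2 * m * ((1 - 2 * x) * h x) ^ 2) := by
        simp only [hG]; push_cast; ring
      have : 0 ≤ (x * (1 - x)) ^ m * (((1 - 2 * x) * h x + 2 * (x * (1 - x)) * h' x) ^ 2
            + 4 * (x * (1 - x)) * (h x) ^ 2 + 2 * m * ((1 - 2 * x) * h x) ^ 2) := by positivity
      linarith
  rw [intervalIntegral.integral_add (by exact (by fun_prop : Continuous _).intervalIntegrable _ _)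
    (by exact (by fun_prop : Continuous _).intervalIntegrable _ _),
    intervalIntegral.integral_const_mul, hint] at key
  linarith

lemma aux_sup1 (h h' : ℝ → ℝ) (hd : ∀ x, HasDerivAt h (h' x) x) (hc : Continuous h')
    (y : ℝ) (hy0 : 0 ≤ y) (hy1 : y ≤ 1) :
    (h y) ^ 2 ≤ ∫ x in (0:ℝ)..1, (2 * (h x) ^ 2 + (h' x) ^ 2) := by
  have hcont : Continuous h := continuous_iff_continuousAt.2 fun x => (hd x).continuousAt
  have hder : ∀ (c x : ℝ), HasDerivAt (fun s => (s - c) * (h s) ^ 2)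
      ((h x) ^ 2 + (x - c) * (2 * h x * h' x)) x := by
    intro c x
    have := ((hasDerivAt_id x).sub_const c).mul ((hd x).fun_pow 2)
    exact this.congr_deriv (by simp)
  have e1 : ∫ x in (0:ℝ)..y, ((h x) ^ 2 + (x - 0) * (2 * h x * h' x)) = y * (h y) ^ 2 := by
    rw [intervalIntegral.integral_eq_sub_of_hasDerivAt (fun x _ => hder 0 x)
      ((by fun_prop : Continuous _).intervalIntegrable _ _)]
    simp
  have e2 : ∫ x in y..(1:ℝ), ((h x) ^ 2 + (x - 1) * (2 * h x * h' x)) = (1 - y) * (h y) ^ 2 := by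
    rw [intervalIntegral.integral_eq_sub_of_hasDerivAt (fun x _ => hder 1 x)
      ((by fun_prop : Continuous _).intervalIntegrable _ _)]
    simp; ring
  have i1 : ∫ x in (0:ℝ)..y, ((h x) ^ 2 + (x - 0) * (2 * h x * h' x)) ≤
      ∫ x in (0:ℝ)..y, (2 * (h x) ^ 2 + (h' x) ^ 2) := by
    apply intervalIntegral.integral_mono_on hy0
    · exact (by fun_prop : Continuous _).intervalIntegrable _ _
    · exact (by fun_prop : Continuous _).intervalIntegrable _ _
    · intro x hx
      have hx1 : x ≤ 1 := hx.2.trans hy1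
      nlinarith [sq_nonneg (h x - x * h' x), sq_nonneg (h' x), mul_nonneg (by nlinarith [hx.1] : 0 ≤ 1 - x ^ 2) (sq_nonneg (h' x))]
  have i2 : ∫ x in y..(1:ℝ), ((h x) ^ 2 + (x - 1) * (2 * h x * h' x)) ≤
      ∫ x in y..(1:ℝ), (2 * (h x) ^ 2 + (h' x) ^ 2) := by
    apply intervalIntegral.integral_mono_on hy1
    · exact (by fun_prop : Continuous _).intervalIntegrable _ _
    · exact (by fun_prop : Continuous _).intervalIntegrable _ _
    · intro x hx
      have hx1 : 0 ≤ x := hy0.trans hx.1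
      nlinarith [sq_nonneg (h x - (x - 1) * h' x), mul_nonneg (by nlinarith [hx.2] : 0 ≤ 1 - (x - 1) ^ 2) (sq_nonneg (h' x))]
  have e3 := intervalIntegral.integral_add_adjacent_intervals (μ := volume)
    (f := fun x => 2 * (h x) ^ 2 + (h' x) ^ 2) (a := 0) (b := y) (c := 1)
    ((by fun_prop : Continuous _).intervalIntegrable _ _)
    ((by fun_prop : Continuous _).intervalIntegrable _ _)
  nlinarith

/-! ### Two-dimensional versions -/

lemma aux_intOn {f : ℝ × ℝ → ℝ} (hf : Continuous f) : IntegrableOn f Oset := by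
  have : IntegrableOn f (Set.Icc (0:ℝ) 1 ×ˢ Set.Icc (0:ℝ) 1) :=
    hf.continuousOn.integrableOn_compact (isCompact_Icc.prod isCompact_Icc)
  exact this.mono_set (Set.prod_mono Set.Ioo_subset_Icc_self Set.Ioo_subset_Icc_self)

lemma aux_meas : MeasurableSet Oset := measurableSet_Ioo.prod measurableSet_Ioo

lemma aux_fub {f : ℝ × ℝ → ℝ} (hf : Continuous f) :
    ∫ x in Oset, f x = ∫ r in (0:ℝ)..1, ∫ s in (0:ℝ)..1, f (r, s) := by
  have h1 : ∫ x in Oset, f x = ∫ r in Set.Ioo (0:ℝ) 1, ∫ s in Set.Ioo (0:ℝ) 1, f (r, s) := by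
    have := aux_intOn hf
    unfold Oset at *
    rw [Measure.volume_eq_prod] at *
    exact setIntegral_prod f this
  rw [h1, intervalIntegral.integral_of_le zero_le_one, integral_Ioc_eq_integral_Ioo]
  congr 1
  ext r
  rw [intervalIntegral.integral_of_le zero_le_one, integral_Ioc_eq_integral_Ioo]

lemma aux_parcont {f : ℝ × ℝ → ℝ} (hf : Continuous f) :
    Continuous fun r => ∫ s in (0:ℝ)..1, f (r, s) :=
  intervalIntegral.continuous_parametric_intervalIntegral_of_continuous' (f := fun r s => f (r, s))
    hf 0 1

lemma aux_sm1 {f : ℝ × ℝ → F} (hf : ContDiff ℝ ∞ f) : ContDiff ℝ ∞ (pd1 f) :=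
  (hf.fderiv_right (m := ∞) (by simp)).clm_apply contDiff_const

lemma aux_sm2 {f : ℝ × ℝ → F} (hf : ContDiff ℝ ∞ f) : ContDiff ℝ ∞ (pd2 f) :=
  (hf.fderiv_right (m := ∞) (by simp)).clm_apply contDiff_const

lemma aux_hd1 {f : ℝ × ℝ → F} (hf : ContDiff ℝ ∞ f) (r s : ℝ) :
    HasDerivAt (fun y => f (y, s)) (pd1 f (r, s)) r := by
  have h := (hf.differentiable (by simp) (r, s)).hasFDerivAt
  exact h.comp_hasDerivAt r ((hasDerivAt_id r).prodMk (hasDerivAt_const r s))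

lemma aux_hd2 {f : ℝ × ℝ → F} (hf : ContDiff ℝ ∞ f) (r s : ℝ) :
    HasDerivAt (fun y => f (r, y)) (pd2 f (r, s)) s := by
  have h := (hf.differentiable (by simp) (r, s)).hasFDerivAt
  exact h.comp_hasDerivAt s ((hasDerivAt_const s r).prodMk (hasDerivAt_id s))

lemma aux_comm {f : ℝ × ℝ → F} (hf : ContDiff ℝ ∞ f) : pd2 (pd1 f) = pd1 (pd2 f) := by
  ext1 x
  have hd : DifferentiableAt ℝ (fderiv ℝ f) x :=
    (hf.fderiv_right (m := ∞) (by simp)).differentiable (by simp) x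
  have hs : IsSymmSndFDerivAt ℝ f x := 
    (contDiff_infty.1 hf 2).contDiffAt.isSymmSndFDerivAt (by simp)
  have k : ∀ a b : ℝ × ℝ, fderiv ℝ (fun y => fderiv ℝ f y a) x b = fderiv ℝ (fderiv ℝ f) x b a := by
    intro a b
    rw [fderiv_clm_apply hd (differentiableAt_const _)]
    simp
  unfold pd1 pd2
  rw [k, k]
  exact hs _ _

/-- weighted square integral -/
def auxQ (m : ℕ) (u : ℝ × ℝ → ℝ) : ℝ := ∫ x in Oset, (x.2 * (1 - x.2)) ^ m * (u x) ^ 2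

lemma auxQ_hardy {u : ℝ × ℝ → ℝ} (hu : ContDiff ℝ ∞ u) (m : ℕ) :
    auxQ m u ≤ 12 * auxQ (m + 1) u + 4 * auxQ (m + 2) (pd2 u) := by
  have c0 := hu.continuous
  have c2 := (aux_sm2 hu).continuous
  unfold auxQ
  rw [← integral_const_mul, ← integral_const_mul, ← integral_add
    (aux_intOn (by fun_prop)) (aux_intOn (by fun_prop)), aux_fub (by fun_prop),
    aux_fub (by fun_prop)]
  apply intervalIntegral.integral_mono_on zero_le_one
  · exact (aux_parcont (f := fun x => (x.2 * (1 - x.2)) ^ m * (u x) ^ 2) (by fun_prop)).intervalIntegrable _ _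
  · exact (aux_parcont (f := fun x => 12 * ((x.2 * (1 - x.2)) ^ (m + 1) * (u x) ^ 2)
      + 4 * ((x.2 * (1 - x.2)) ^ (m + 2) * (pd2 u x) ^ 2)) (by fun_prop)).intervalIntegrable _ _
  · intro r _
    exact aux_hardy1 (fun s => u (r, s)) (fun s => pd2 u (r, s)) (aux_hd2 hu r)
      (by fun_prop) m

lemma auxQ_sup {u : ℝ × ℝ → ℝ} (hu : ContDiff ℝ ∞ u) (x : ℝ × ℝ) (hx : x ∈ Oset) :
    (u x) ^ 2 ≤ 4 * auxQ 0 u + 2 * auxQ 0 (pd1 u) + 2 * auxQ 0 (pd2 u) + auxQ 0 (pd2 (pd1 u)) := by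
  obtain ⟨a, b⟩ := x
  obtain ⟨⟨ha0, ha1⟩, hb0, hb1⟩ := hx
  simp only at ha0 ha1 hb0 hb1
  have c0 := hu.continuous
  have c1 := (aux_sm1 hu).continuous
  have c2 := (aux_sm2 hu).continuous
  have c12 := (aux_sm2 (aux_sm1 hu)).continuous
  have s1 := aux_sup1 (fun r => u (r, b)) (fun r => pd1 u (r, b)) (fun r => aux_hd1 hu r b)
    (by fun_prop) a ha0.le ha1.le
  refine s1.trans ?_
  have e : 4 * auxQ 0 u + 2 * auxQ 0 (pd1 u) + 2 * auxQ 0 (pd2 u) + auxQ 0 (pd2 (pd1 u))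
      = ∫ r in (0:ℝ)..1, ((2 * ∫ s in (0:ℝ)..1, (2 * (u (r, s)) ^ 2 + (pd2 u (r, s)) ^ 2))
        + ∫ s in (0:ℝ)..1, (2 * (pd1 u (r, s)) ^ 2 + (pd2 (pd1 u) (r, s)) ^ 2)) := by
    have f1 := aux_fub (f := fun x => 2 * (u x) ^ 2 + (pd2 u x) ^ 2) (by fun_prop)
    have f2 := aux_fub (f := fun x => 2 * (pd1 u x) ^ 2 + (pd2 (pd1 u) x) ^ 2) (by fun_prop)
    rw [integral_add (aux_intOn (by fun_prop)) (aux_intOn (by fun_prop)), integral_const_mul] at f1 f2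
    rw [intervalIntegral.integral_add, intervalIntegral.integral_const_mul, ← f1, ← f2]
    · simp only [auxQ, pow_zero, one_mul]; ring
    · exact ((aux_parcont (f := fun x => 2 * (u x) ^ 2 + (pd2 u x) ^ 2)
        (by fun_prop)).const_mul 2).intervalIntegrable _ _
    · exact (aux_parcont (f := fun x => 2 * (pd1 u x) ^ 2 + (pd2 (pd1 u) x) ^ 2)
        (by fun_prop)).intervalIntegrable _ _
  rw [e]
  apply intervalIntegral.integral_mono_on zero_le_one
  · exact (by fun_prop : Continuous _).intervalIntegrable _ _
  · exact (((aux_parcont (f := fun x => 2 * (u x) ^ 2 + (pd2 u x) ^ 2)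
        (by fun_prop)).const_mul 2).add (aux_parcont (f := fun x => 2 * (pd1 u x) ^ 2 + (pd2 (pd1 u) x) ^ 2)
        (by fun_prop))).intervalIntegrable _ _
  · intro r _
    have t1 := aux_sup1 (fun s => u (r, s)) (fun s => pd2 u (r, s)) (aux_hd2 hu r)
      (by fun_prop) b hb0.le hb1.le
    have t2 := aux_sup1 (fun s => pd1 u (r, s)) (fun s => pd2 (pd1 u) (r, s))
      (aux_hd2 (aux_sm1 hu) r) (by fun_prop) b hb0.le hb1.le
    linarith

/-! ### Mixed derivatives and the energy -/

lemma aux_pdt {v : ℝ → ℝ × ℝ → ℝ × ℝ} (hv : SmoothT v) (t : ℝ) : ContDiff ℝ ∞ (pdt v t) := by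
  have hV : ContDiff ℝ ∞ (fun p : ℝ × (ℝ × ℝ) => v p.1 p.2) := contDiff_infty.2 hv
  have e : pdt v t = fun x =>
      fderiv ℝ (fun p : ℝ × (ℝ × ℝ) => v p.1 p.2) (t, x) ((1 : ℝ), (0 : ℝ × ℝ)) := by
    ext1 x
    have h := (hV.differentiable (by simp) (t, x)).hasFDerivAt
    have h2 := h.comp_hasDerivAt t ((hasDerivAt_id t).prodMk (hasDerivAt_const t x))
    exact h2.deriv
  rw [e]
  exact ((hV.fderiv_right (m := ∞) (by simp)).comp (contDiff_const.prodMk contDiff_id)).clm_apply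
    contDiff_const

/-- mixed derivative -/
def auxD (a b : ℕ) (w : ℝ × ℝ → F) : ℝ × ℝ → F := pd1^[a] (pd2^[b] w)

lemma auxD_smooth {w : ℝ × ℝ → F} (hw : ContDiff ℝ ∞ w) (a b : ℕ) :
    ContDiff ℝ ∞ (auxD a b w) := by
  unfold auxD
  induction a with
  | zero =>
    induction b with
    | zero => exact hw
    | succ b ih =>
      simp only [Function.iterate_zero, id] at ih ⊢
      rw [Function.iterate_succ_apply']
      exact aux_sm2 ih
  | succ a ih =>
    rw [Function.iterate_succ_apply']
    exact aux_sm1 ih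

lemma auxD_pd1 (w : ℝ × ℝ → F) (a b : ℕ) : pd1 (auxD a b w) = auxD (a + 1) b w := by
  unfold auxD
  rw [Function.iterate_succ_apply']

lemma auxD_pd2 {w : ℝ × ℝ → F} (hw : ContDiff ℝ ∞ w) (a b : ℕ) :
    pd2 (auxD a b w) = auxD a (b + 1) w := by
  induction a with
  | zero =>
    unfold auxD
    simp only [Function.iterate_zero, id]
    rw [Function.iterate_succ_apply']
  | succ a ih =>
    rw [← auxD_pd1, aux_comm (auxD_smooth hw a b), ih, auxD_pd1]

lemma auxL_pd1 (L : (ℝ × ℝ) →L[ℝ] ℝ) {f : ℝ × ℝ → ℝ × ℝ} (hf : ContDiff ℝ ∞ f) :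
    pd1 (fun x => L (f x)) = fun x => L (pd1 f x) := by
  ext1 x
  have h := L.hasFDerivAt.comp x (hf.differentiable (by simp) x).hasFDerivAt
  unfold pd1
  exact congrArg (fun A => A ((1:ℝ), (0:ℝ))) h.fderiv

lemma auxL_pd2 (L : (ℝ × ℝ) →L[ℝ] ℝ) {f : ℝ × ℝ → ℝ × ℝ} (hf : ContDiff ℝ ∞ f) :
    pd2 (fun x => L (f x)) = fun x => L (pd2 f x) := by
  ext1 x
  have h := L.hasFDerivAt.comp x (hf.differentiable (by simp) x).hasFDerivAt
  unfold pd2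
  exact congrArg (fun A => A ((0:ℝ), (1:ℝ))) h.fderiv

lemma aux_dist {x : ℝ × ℝ} (hx : x ∈ Oset) :
    0 ≤ x.2 * (1 - x.2) ∧ x.2 * (1 - x.2) ≤ 1 ∧ x.2 * (1 - x.2) ≤ distG x := by
  obtain ⟨_, h0, h1⟩ := hx
  refine ⟨mul_nonneg h0.le (by linarith), by nlinarith, le_min (by nlinarith) (by nlinarith)⟩

lemma aux_rho_nonneg {C₁ C₂ : ℝ} (hC₁ : 0 < C₁) {ρ₀ : ℝ × ℝ → ℝ} (hρ : IsDensity C₁ C₂ ρ₀)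
    {x : ℝ × ℝ} (hx : x ∈ Oset) : 0 ≤ ρ₀ x := by
  obtain ⟨h0, h1, h2⟩ := aux_dist hx
  exact (mul_nonneg hC₁.le (h0.trans h2)).trans (hρ.2.2.2 x hx).1

section En
variable {C₁ C₂ : ℝ} {ρ₀ : ℝ × ℝ → ℝ} {v : ℝ → ℝ × ℝ → ℝ × ℝ} {t : ℝ}

lemma aux_n1 (hC₁ : 0 < C₁) (hρ : IsDensity C₁ C₂ ρ₀) (f : ℝ × ℝ → ℝ × ℝ) :
    0 ≤ ∫ x in Oset, ρ₀ x * ‖f x‖ ^ 2 :=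
  setIntegral_nonneg aux_meas fun _ hx => mul_nonneg (aux_rho_nonneg hC₁ hρ hx) (by positivity)

lemma aux_n2 (hC₁ : 0 < C₁) (hρ : IsDensity C₁ C₂ ρ₀) (f g : ℝ × ℝ → ℝ × ℝ) :
    0 ≤ ∫ x in Oset, ρ₀ x * (gradSq f x + gradSq g x) :=
  setIntegral_nonneg aux_meas fun _ hx =>
    mul_nonneg (aux_rho_nonneg hC₁ hρ hx) (by unfold gradSq; positivity)

lemma aux_n3 (hC₁ : 0 < C₁) (hρ : IsDensity C₁ C₂ ρ₀) (k : ℕ) (f : ℝ × ℝ → ℝ × ℝ) :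
    0 ≤ ∫ x in Oset, ρ₀ x ^ k * ‖f x‖ ^ 2 :=
  setIntegral_nonneg aux_meas fun _ hx =>
    mul_nonneg (pow_nonneg (aux_rho_nonneg hC₁ hρ hx) k) (by positivity)

lemma aux_en2 (hC₁ : 0 < C₁) (hρ : IsDensity C₁ C₂ ρ₀) (a : ℕ) (ha : a ≤ 4) :
    ∫ x in Oset, ρ₀ x * (gradSq (pd1^[a] (pdt v t)) x + gradSq (pd1^[a + 1] (pdt v t)) x)
      ≤ energy ρ₀ v t := by
  set S := fun l₀ l₁ : ℕ => ∫ x in Oset, ρ₀ x *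
          (gradSq (pd1^[l₁] ((pdt^[l₀] v) t)) x + gradSq (pd1^[l₁ + 1] ((pdt^[l₀] v) t)) x) with hS
  have hS0 : ∀ l₀ l₁, 0 ≤ S l₀ l₁ := fun l₀ l₁ => aux_n2 hC₁ hρ _ _
  have h1 : S 1 a ≤ ∑ l₁ ∈ Finset.range (7 - 2 * 1), S 1 l₁ :=
    Finset.single_le_sum (f := fun l₁ => S 1 l₁) (fun i _ => hS0 1 i)
      (Finset.mem_range.2 (by omega))
  have h2 : ∑ l₁ ∈ Finset.range (7 - 2 * 1), S 1 l₁
      ≤ ∑ l₀ ∈ Finset.range 4, ∑ l₁ ∈ Finset.range (7 - 2 * l₀), S l₀ l₁ :=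
    Finset.single_le_sum (f := fun l₀ => ∑ l₁ ∈ Finset.range (7 - 2 * l₀), S l₀ l₁)
      (fun i _ => Finset.sum_nonneg fun j _ => hS0 i j) (Finset.mem_range.2 (by omega))
  refine (h1.trans h2).trans ?_
  unfold energy
  have h3 : 0 ≤ ∑ l₀ ∈ Finset.range 5, ∫ x in Oset, ρ₀ x * ‖(pdt^[l₀] v) t x‖ ^ 2 :=
    Finset.sum_nonneg fun i _ => aux_n1 hC₁ hρ _
  have h4 : 0 ≤ ∑ l₀ ∈ Finset.range 4, ∑ l₁ ∈ Finset.range (7 - 2 * l₀),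
        ∑ l₂ ∈ Finset.Icc 2 (8 - 2 * l₀ - l₁),
          ∫ x in Oset, ρ₀ x ^ l₂ * ‖(pd1^[l₁] (pd2^[l₂] ((pdt^[l₀] v) t))) x‖ ^ 2 :=
    Finset.sum_nonneg fun i _ => Finset.sum_nonneg fun j _ => Finset.sum_nonneg fun k _ =>
      aux_n3 hC₁ hρ _ _
  linarith

lemma aux_en3 (hC₁ : 0 < C₁) (hρ : IsDensity C₁ C₂ ρ₀) (a b : ℕ) (ha : a ≤ 4) (hb : 2 ≤ b)
    (hab : a + b ≤ 6) :
    ∫ x in Oset, ρ₀ x ^ b * ‖auxD a b (pdt v t) x‖ ^ 2 ≤ energy ρ₀ v t := by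
  set S := fun l₀ l₁ l₂ : ℕ => ∫ x in Oset, ρ₀ x ^ l₂ *
    ‖(pd1^[l₁] (pd2^[l₂] ((pdt^[l₀] v) t))) x‖ ^ 2 with hS
  have hS0 : ∀ l₀ l₁ l₂, 0 ≤ S l₀ l₁ l₂ := fun l₀ l₁ l₂ => aux_n3 hC₁ hρ _ _
  have h0 : S 1 a b ≤ ∑ l₂ ∈ Finset.Icc 2 (8 - 2 * 1 - a), S 1 a l₂ :=
    Finset.single_le_sum (f := fun l₂ => S 1 a l₂) (fun i _ => hS0 1 a i)
      (Finset.mem_Icc.2 (by omega))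
  have h1 : ∑ l₂ ∈ Finset.Icc 2 (8 - 2 * 1 - a), S 1 a l₂ ≤
      ∑ l₁ ∈ Finset.range (7 - 2 * 1), ∑ l₂ ∈ Finset.Icc 2 (8 - 2 * 1 - l₁), S 1 l₁ l₂ :=
    Finset.single_le_sum (f := fun l₁ => ∑ l₂ ∈ Finset.Icc 2 (8 - 2 * 1 - l₁), S 1 l₁ l₂)
      (fun i _ => Finset.sum_nonneg fun j _ => hS0 1 i j)
      (Finset.mem_range.2 (by omega))
  have h2 : ∑ l₁ ∈ Finset.range (7 - 2 * 1), ∑ l₂ ∈ Finset.Icc 2 (8 - 2 * 1 - l₁), S 1 l₁ l₂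
      ≤ ∑ l₀ ∈ Finset.range 4, ∑ l₁ ∈ Finset.range (7 - 2 * l₀),
        ∑ l₂ ∈ Finset.Icc 2 (8 - 2 * l₀ - l₁), S l₀ l₁ l₂ :=
    Finset.single_le_sum (f := fun l₀ => ∑ l₁ ∈ Finset.range (7 - 2 * l₀),
        ∑ l₂ ∈ Finset.Icc 2 (8 - 2 * l₀ - l₁), S l₀ l₁ l₂)
      (fun i _ => Finset.sum_nonneg fun j _ => Finset.sum_nonneg fun k _ => hS0 i j k)
      (Finset.mem_range.2 (by omega))
  refine (h0.trans (h1.trans h2)).trans ?_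
  unfold energy
  have h3 : 0 ≤ ∑ l₀ ∈ Finset.range 5, ∫ x in Oset, ρ₀ x * ‖(pdt^[l₀] v) t x‖ ^ 2 :=
    Finset.sum_nonneg fun i _ => aux_n1 hC₁ hρ _
  have h4 : 0 ≤ ∑ l₀ ∈ Finset.range 4, ∑ l₁ ∈ Finset.range (7 - 2 * l₀),
        ∫ x in Oset, ρ₀ x *
          (gradSq (pd1^[l₁] ((pdt^[l₀] v) t)) x + gradSq (pd1^[l₁ + 1] ((pdt^[l₀] v) t)) x) :=
    Finset.sum_nonneg fun i _ => Finset.sum_nonneg fun j _ => aux_n2 hC₁ hρ _ _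
  linarith

lemma aux_Qle (hC₁ : 0 < C₁) (hρ : IsDensity C₁ C₂ ρ₀) (L : (ℝ × ℝ) →L[ℝ] ℝ)
    (hL : ∀ z, |L z| ≤ ‖z‖) (g : ℝ × ℝ → ℝ × ℝ) (hg : Continuous g)
    (k m : ℕ) (hkm : k ≤ m) (hk : k ≤ 4) (R : ℝ × ℝ → ℝ) (hR : Continuous R)
    (hgR : ∀ x ∈ Oset, ρ₀ x ^ k * ‖g x‖ ^ 2 ≤ R x) (E : ℝ) (hE : ∫ x in Oset, R x ≤ E) :
    auxQ m (fun x => L (g x)) ≤ (max 1 (1 / C₁)) ^ 4 * E := by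
  set M := max 1 (1 / C₁) with hM
  have hM1 : 1 ≤ M := le_max_left _ _
  have hM0 : 0 < M := by linarith
  have hMC : 1 ≤ M * C₁ := by
    have : 1 / C₁ ≤ M := le_max_right _ _
    rwa [div_le_iff₀ hC₁] at this
  refine le_trans ?_ (mul_le_mul_of_nonneg_left hE (by positivity))
  rw [← integral_const_mul]
  unfold auxQ
  have hLc := L.continuous
  apply setIntegral_mono_on (aux_intOn (by fun_prop)) (aux_intOn (by fun_prop)) aux_meas
  intro x hx
  obtain ⟨q0, q1, qd⟩ := aux_dist hx
  have hρ0 := aux_rho_nonneg hC₁ hρ hx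
  have hqρ : x.2 * (1 - x.2) ≤ M * ρ₀ x := by
    have := (hρ.2.2.2 x hx).1
    calc x.2 * (1 - x.2) ≤ 1 * distG x := by linarith
      _ ≤ (M * C₁) * distG x := mul_le_mul_of_nonneg_right hMC (q0.trans qd)
      _ = M * (C₁ * distG x) := by ring
      _ ≤ M * ρ₀ x := mul_le_mul_of_nonneg_left this hM0.le
  have p1 : (x.2 * (1 - x.2)) ^ m ≤ M ^ 4 * ρ₀ x ^ k := by
    calc (x.2 * (1 - x.2)) ^ m ≤ (x.2 * (1 - x.2)) ^ k := pow_le_pow_of_le_one q0 q1 hkm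
      _ ≤ (M * ρ₀ x) ^ k := pow_le_pow_left₀ q0 hqρ k
      _ = M ^ k * ρ₀ x ^ k := mul_pow _ _ _
      _ ≤ M ^ 4 * ρ₀ x ^ k :=
        mul_le_mul_of_nonneg_right (pow_le_pow_right₀ hM1 hk) (pow_nonneg hρ0 k)
  have p2 : (L (g x)) ^ 2 ≤ ‖g x‖ ^ 2 := by
    rw [← sq_abs]
    exact pow_le_pow_left₀ (abs_nonneg _) (hL _) 2
  calc (x.2 * (1 - x.2)) ^ m * (L (g x)) ^ 2 ≤ (M ^ 4 * ρ₀ x ^ k) * ‖g x‖ ^ 2 :=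
        mul_le_mul p1 p2 (sq_nonneg _) (by positivity)
    _ = M ^ 4 * (ρ₀ x ^ k * ‖g x‖ ^ 2) := by ring
    _ ≤ M ^ 4 * R x := mul_le_mul_of_nonneg_left (hgR x hx) (by positivity)

lemma aux_gradcont {f : ℝ × ℝ → ℝ × ℝ} (hf : ContDiff ℝ ∞ f) : Continuous (gradSq f) := by
  have c1 := (aux_sm1 hf).continuous
  have c2 := (aux_sm2 hf).continuous
  unfold gradSq
  fun_prop

lemma aux_final (hC₁ : 0 < C₁) (hρ : IsDensity C₁ C₂ ρ₀) (hv : SmoothT v)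
    (L : (ℝ × ℝ) →L[ℝ] ℝ) (hL : ∀ z, |L z| ≤ ‖z‖) (x : ℝ × ℝ) (hx : x ∈ Oset) :
    (L (pd1 (pd1 (pdt v t)) x)) ^ 2 ≤ 1000 * ((max 1 (1 / C₁)) ^ 4 * energy ρ₀ v t) ∧
    (L (pd2 (pd1 (pdt v t)) x)) ^ 2 ≤ 1000 * ((max 1 (1 / C₁)) ^ 4 * energy ρ₀ v t) := by
  set w := pdt v t with hwdef
  have hw : ContDiff ℝ ∞ w := aux_pdt hv t
  have hρc : Continuous ρ₀ := (hρ.1 0).continuous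
  set B := (max 1 (1 / C₁)) ^ 4 * energy ρ₀ v t with hB
  have hDs := fun a b => auxD_smooth hw a b
  have hLs : ∀ a b, ContDiff ℝ ∞ (fun x => L (auxD a b w x)) := fun a b =>
    L.contDiff.comp (hDs a b)
  have hL1 : ∀ a b, pd1 (fun x => L (auxD a b w x)) = fun x => L (auxD (a + 1) b w x) := by
    intro a b
    rw [auxL_pd1 L (hDs a b), auxD_pd1]
  have hL2 : ∀ a b, pd2 (fun x => L (auxD a b w x)) = fun x => L (auxD a (b + 1) w x) := by
    intro a b
    rw [auxL_pd2 L (hDs a b), auxD_pd2 hw]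
  -- the quantities
  set e : ℕ → ℕ → ℕ → ℝ := fun a b m => auxQ m (fun x => L (auxD a b w x)) with he
  have hH : ∀ a b m, e a b m ≤ 12 * e a b (m + 1) + 4 * e a (b + 1) (m + 2) := by
    intro a b m
    have := auxQ_hardy (hLs a b) m
    rw [hL2] at this
    exact this
  have hR : ∀ a, Continuous (fun x => ρ₀ x * (gradSq (pd1^[a] w) x + gradSq (pd1^[a + 1] w) x)) := by
    intro a
    have c1 := aux_gradcont (hDs a 0)
    have c2 := aux_gradcont (hDs (a + 1) 0)
    exact hρc.mul (c1.add c2)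
  have g0 : ∀ a m, a ≤ 4 → 1 ≤ m → e (a + 1) 0 m ≤ B := by
    intro a m ha hm
    refine aux_Qle hC₁ hρ L hL _ (hDs _ _).continuous 1 m hm (by norm_num) _ (hR a) ?_ _
      (aux_en2 hC₁ hρ a ha)
    intro y hy
    rw [pow_one]
    refine mul_le_mul_of_nonneg_left ?_ (aux_rho_nonneg hC₁ hρ hy)
    have : auxD (a + 1) 0 w = pd1 (pd1^[a] w) := (auxD_pd1 w a 0).symm
    rw [this]
    unfold gradSq
    nlinarith [sq_nonneg ‖pd2 (pd1^[a] w) y‖, sq_nonneg ‖pd1 (pd1^[a+1] w) y‖,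
      sq_nonneg ‖pd2 (pd1^[a+1] w) y‖]
  have g1 : ∀ a m, a ≤ 4 → 1 ≤ m → e a 1 m ≤ B := by
    intro a m ha hm
    refine aux_Qle hC₁ hρ L hL _ (hDs _ _).continuous 1 m hm (by norm_num) _ (hR a) ?_ _
      (aux_en2 hC₁ hρ a ha)
    intro y hy
    rw [pow_one]
    refine mul_le_mul_of_nonneg_left ?_ (aux_rho_nonneg hC₁ hρ hy)
    have : auxD a 1 w = pd2 (pd1^[a] w) := (auxD_pd2 hw a 0).symm
    rw [this]
    unfold gradSq
    nlinarith [sq_nonneg ‖pd1 (pd1^[a] w) y‖, sq_nonneg ‖pd1 (pd1^[a+1] w) y‖,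
      sq_nonneg ‖pd2 (pd1^[a+1] w) y‖]
  have g2 : ∀ a b, a ≤ 4 → 2 ≤ b → b ≤ 4 → a + b ≤ 6 → e a b b ≤ B := by
    intro a b ha hb hb4 hab
    have hc := (hDs a b).continuous
    exact aux_Qle hC₁ hρ L hL _ hc b b le_rfl hb4
      (fun y => ρ₀ y ^ b * ‖auxD a b w y‖ ^ 2) (by fun_prop) (fun y _ => le_rfl) _
      (aux_en3 hC₁ hρ a b ha hb hab)
  have k0 : ∀ a, a ≤ 3 → e (a + 1) 0 0 ≤ 16 * B := by
    intro a ha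
    have := hH (a + 1) 0 0
    have := g0 a 1 (by omega) le_rfl
    have := g1 (a + 1) 2 (by omega) (by norm_num)
    simp only [zero_add] at *
    linarith
  have k1 : ∀ a, a ≤ 4 → e a 1 0 ≤ 16 * B := by
    intro a ha
    have h1 := hH a 1 0
    have h2 := g1 a 1 (by omega) le_rfl
    have h3 := g2 a 2 (by omega) le_rfl (by norm_num) (by omega)
    norm_num at h1
    linarith
  have k2 : ∀ a, a ≤ 2 → e a 2 0 ≤ 256 * B := by
    intro a ha
    have h1 := hH a 2 0
    have h2 := hH a 2 1
    have h3 := hH a 3 2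
    have h4 := g2 a 2 (by omega) le_rfl (by norm_num) (by omega)
    have h5 := g2 a 3 (by omega) (by norm_num) (by norm_num) (by omega)
    have h6 := g2 a 4 (by omega) (by norm_num) (by norm_num) (by omega)
    norm_num at h1 h2 h3
    linarith
  have s1 := auxQ_sup (hLs 2 0) x hx
  have s2 := auxQ_sup (hLs 1 1) x hx
  rw [hL1, hL2, hL2] at s1 s2
  have B0 : 0 ≤ B := by
    have : 0 ≤ e 1 1 1 := setIntegral_nonneg aux_meas fun y hy =>
      mul_nonneg (pow_nonneg (aux_dist hy).1 _) (sq_nonneg _)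
    exact this.trans (g1 1 1 (by norm_num) le_rfl)
  have d1 : pd1 (pd1 w) = auxD 2 0 w := rfl
  have d2 : pd2 (pd1 w) = auxD 1 1 w := auxD_pd2 hw 1 0
  rw [d1, d2]
  constructor
  · have a1 : e 2 0 0 ≤ 16 * B := k0 1 (by norm_num)
    have a2 : e 3 0 0 ≤ 16 * B := k0 2 (by norm_num)
    have a3 := k1 2 (by norm_num)
    have a4 := k1 3 (by norm_num)
    simp only [he] at a1 a2 a3 a4
    norm_num at s1
    linarith
  · have a1 := k1 1 (by norm_num)
    have a2 := k1 2 (by norm_num)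
    have a3 := k2 1 (by norm_num)
    have a4 := k2 2 (by norm_num)
    simp only [he] at a1 a2 a3 a4
    norm_num at s2
    linarith

end En

lemma aux_normsq (z : ℝ × ℝ) (c : ℝ) (h1 : z.1 ^ 2 ≤ c) (h2 : z.2 ^ 2 ≤ c) : ‖z‖ ≤ √c := by
  rw [Prod.norm_def]
  exact max_le (Real.abs_le_sqrt h1) (Real.abs_le_sqrt h2)

/-- (Lemma 3.9.) `‖∂ₜ∂₁Dv(t)‖_{L^∞(Ω)} ≤ C E(t,v)^{1/2}`. -/
theorem stmt6 (C₁ C₂ : ℝ) (hC₁ : 0 < C₁) (hC₁₂ : C₁ ≤ C₂) :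
    ∃ C > (0:ℝ),
      ∀ ρ₀ : ℝ × ℝ → ℝ, IsDensity C₁ C₂ ρ₀ →
        ∀ T : ℝ, 0 ≤ T →
          ∀ v : ℝ → ℝ × ℝ → ℝ × ℝ, SmoothT v → PerT v →
            ∀ t ∈ Set.Icc (0:ℝ) T,
              ∀ x ∈ Oset, ‖iteratedFDeriv ℝ 1 (pd1 (pdt v t)) x‖
                ≤ C * Real.sqrt (energy ρ₀ v t) := by
  set M := max 1 (1 / C₁) with hM
  have hM1 : 1 ≤ M := le_max_left _ _
  have hM0 : 0 < M := by linarith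
  refine ⟨2 * √(1000 * M ^ 4), by positivity, ?_⟩
  intro ρ₀ hρ T _ v hv _ t _ x hx
  have hf := aux_final (t := t) hC₁ hρ hv (ContinuousLinearMap.fst ℝ ℝ ℝ)
    (fun z => norm_fst_le z) x hx
  have hs := aux_final (t := t) hC₁ hρ hv (ContinuousLinearMap.snd ℝ ℝ ℝ)
    (fun z => norm_snd_le z) x hx
  have n1 := aux_normsq _ _ hf.1 hs.1
  have n2 := aux_normsq _ _ hf.2 hs.2
  rw [← mul_assoc, Real.sqrt_mul (by positivity)] at n1 n2
  rw [norm_iteratedFDeriv_one]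
  refine ContinuousLinearMap.opNorm_le_bound _ (by positivity) ?_
  intro z
  have ez : z = z.1 • ((1:ℝ), (0:ℝ)) + z.2 • ((0:ℝ), (1:ℝ)) := by
    ext <;> simp
  have e1 : fderiv ℝ (pd1 (pdt v t)) x z
      = z.1 • pd1 (pd1 (pdt v t)) x + z.2 • pd2 (pd1 (pdt v t)) x := by
    conv_lhs => rw [ez]
    rw [map_add, map_smul, map_smul]
    rfl
  rw [e1]
  refine (norm_add_le _ _).trans ?_
  rw [norm_smul, norm_smul]
  have m1 := mul_le_mul (norm_fst_le z) n1 (norm_nonneg _) (norm_nonneg _)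
  have m2 := mul_le_mul (norm_snd_le z) n2 (norm_nonneg _) (norm_nonneg _)
  linarith
end
end

section
/- Let v : Ω̄×[0,T] → ℝ² be C¹, let η(x,t) = x + ∫₀ᵗ v(x,s) ds, let a be the cofactor matrix of Dη given by a = [[∂₂η², −∂₂η¹], [−∂₁η², ∂₁η¹]], and let b^{kj} = a_l^k a_l^j. If ∫₀ᵗ ‖Dv(s)‖_{L^∞(Ω)} ds ≤ 1/20, then the symmetric matrix (b^{kj}(x,t)) is uniformly positive definite: b^{kj}(x,t) ξ_k ξ_j ≥ |ξ|²/5 for all x ∈ Ω and all ξ ∈ ℝ²; in particular b²²(x,t) ≥ 1/5. -/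
open MeasureTheory Real Filter

noncomputable section

variable {F : Type*} [NormedAddCommGroup F] [NormedSpace ℝ F]

/-- `‖Dv(s)‖_{L^∞(Ω)}`. -/
def dvSup (v : ℝ → ℝ × ℝ → ℝ × ℝ) (s : ℝ) : ℝ :=
  ⨆ x : Oset, ‖fderiv ℝ (v s) (x : ℝ × ℝ)‖

/-- Joint continuity of the spatial derivative. -/
theorem cont_dv (v : ℝ → ℝ × ℝ → ℝ × ℝ)
    (hv : ContDiff ℝ 1 (fun p : ℝ × (ℝ × ℝ) => v p.1 p.2)) :
    Continuous (fun p : ℝ × (ℝ × ℝ) => fderiv ℝ (v p.1) p.2) := by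
  have h : ContDiff ℝ 1 (Function.uncurry (fun (p : ℝ × (ℝ × ℝ)) (y : ℝ × ℝ) => v p.1 y)) :=
    hv.comp (g := fun p : ℝ × (ℝ × ℝ) => v p.1 p.2)
      (f := fun q : (ℝ × (ℝ × ℝ)) × (ℝ × ℝ) => (q.1.1, q.2)) (by fun_prop)
  exact (h.fderiv (n := 0) (g := fun p : ℝ × (ℝ × ℝ) => p.2) (by fun_prop) (by simp)).continuous

theorem Oset_bound (v : ℝ → ℝ × ℝ → ℝ × ℝ)
    (hv : ContDiff ℝ 1 (fun p : ℝ × (ℝ × ℝ) => v p.1 p.2)) (a b : ℝ) :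
    ∃ C : ℝ, ∀ s ∈ Set.Icc a b, ∀ x ∈ Oset, ‖fderiv ℝ (v s) x‖ ≤ C := by
  have hK : IsCompact (Set.Icc a b ×ˢ (Set.Icc (0:ℝ) 1 ×ˢ Set.Icc (0:ℝ) 1)) :=
    isCompact_Icc.prod (isCompact_Icc.prod isCompact_Icc)
  obtain ⟨C, hC⟩ := hK.exists_bound_of_continuousOn (cont_dv v hv).continuousOn
  refine ⟨C, fun s hs x hx => hC (s, x) ⟨hs, ?_, ?_⟩⟩
  · exact Set.Ioo_subset_Icc_self hx.1
  · exact Set.Ioo_subset_Icc_self hx.2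

theorem dv_bdd (v : ℝ → ℝ × ℝ → ℝ × ℝ)
    (hv : ContDiff ℝ 1 (fun p : ℝ × (ℝ × ℝ) => v p.1 p.2)) (s : ℝ) :
    BddAbove (Set.range fun x : Oset => ‖fderiv ℝ (v s) (x : ℝ × ℝ)‖) := by
  obtain ⟨C, hC⟩ := Oset_bound v hv s s
  refine ⟨C, ?_⟩
  rintro _ ⟨x, rfl⟩
  exact hC s ⟨le_rfl, le_rfl⟩ x x.2

theorem dvSup_integrable (v : ℝ → ℝ × ℝ → ℝ × ℝ)
    (hv : ContDiff ℝ 1 (fun p : ℝ × (ℝ × ℝ) => v p.1 p.2)) (t : ℝ) (ht : 0 ≤ t) :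
    IntervalIntegrable (dvSup v) volume 0 t := by
  have hm : Measurable (dvSup v) := by
    apply LowerSemicontinuous.measurable
    refine lowerSemicontinuous_ciSup (f := fun (x : Oset) s => ‖fderiv ℝ (v s) (x : ℝ × ℝ)‖)
      (fun s => dv_bdd v hv s) (fun x => ?_)
    apply Continuous.lowerSemicontinuous
    exact ((cont_dv v hv).comp (Continuous.prodMk_left (x : ℝ × ℝ))).norm
  obtain ⟨C, hC⟩ := Oset_bound v hv 0 t
  have hx0 : ((1/2, 1/2) : ℝ × ℝ) ∈ Oset := by
    constructor <;> constructor <;> norm_num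
  have : Nonempty Oset := ⟨⟨_, hx0⟩⟩
  refine (intervalIntegrable_const (c := C)).mono_fun hm.aestronglyMeasurable ?_
  refine (ae_restrict_iff' measurableSet_uIoc).2 (Eventually.of_forall fun s hs => ?_)
  rw [Set.uIoc_of_le ht] at hs
  have h1 : dvSup v s ≤ C := ciSup_le fun x => hC s ⟨hs.1.le, hs.2⟩ x x.2
  have h0 : 0 ≤ dvSup v s := Real.iSup_nonneg fun x => norm_nonneg _
  beta_reduce
  rw [Real.norm_of_nonneg h0, Real.norm_of_nonneg (h0.trans h1)]
  exact h1

theorem flow_deriv (v : ℝ → ℝ × ℝ → ℝ × ℝ)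
    (hv : ContDiff ℝ 1 (fun p : ℝ × (ℝ × ℝ) => v p.1 p.2)) (t : ℝ) (ht : 0 ≤ t)
    (x : ℝ × ℝ) (hx : x ∈ Oset) :
    HasFDerivAt (flowMap v t)
      (ContinuousLinearMap.id ℝ (ℝ × ℝ) + ∫ s in (0:ℝ)..t, fderiv ℝ (v s) x) x := by
  have hO : IsOpen Oset := isOpen_Ioo.prod isOpen_Ioo
  obtain ⟨C, hC⟩ := Oset_bound v hv 0 t
  have hc : ∀ y : ℝ × ℝ, Continuous (fun s => v s y) := fun y =>
    hv.continuous.comp (Continuous.prodMk_left y)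
  have hcd : Continuous (fun s => fderiv ℝ (v s) x) :=
    (cont_dv v hv).comp (Continuous.prodMk_left x)
  have key : HasFDerivAt (fun y => ∫ s in (0:ℝ)..t, v s y)
      (∫ s in (0:ℝ)..t, fderiv ℝ (v s) x) x := by
    refine intervalIntegral.hasFDerivAt_integral_of_dominated_of_fderiv_le
      (F := fun y s => v s y) (F' := fun y s => fderiv ℝ (v s) y) (bound := fun _ => C)
      (hO.mem_nhds hx)
      (Eventually.of_forall fun y => (hc y).aestronglyMeasurable)
      ((hc x).intervalIntegrable _ _) hcd.aestronglyMeasurable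
      (Eventually.of_forall fun s hs y hy => ?_) intervalIntegrable_const
      (Eventually.of_forall fun s hs y hy => ?_)
    · rw [Set.uIoc_of_le ht] at hs
      exact hC s ⟨hs.1.le, hs.2⟩ y hy
    · have : ContDiff ℝ 1 (v s) :=
        hv.comp (g := fun p : ℝ × (ℝ × ℝ) => v p.1 p.2) (contDiff_prodMk_right s)
      exact (this.differentiable one_ne_zero y).hasFDerivAt
  exact (hasFDerivAt_id x).add key

theorem quad_bound (p q r w a b : ℝ) (hp : |p| ≤ 1/20) (hq : |q| ≤ 1/20) (hr : |r| ≤ 1/20)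
    (hw : |w| ≤ 1/20) :
    (a ^ 2 + b ^ 2) / 5 ≤ ((1 + p) * a - q * b) ^ 2 + ((1 + w) * b - r * a) ^ 2 := by
  have h : ∀ p q a b : ℝ, |p| ≤ 1/20 → |q| ≤ 1/20 →
      a ^ 2 / 2 - (a ^ 2 + b ^ 2) / 10 ≤ ((1 + p) * a - q * b) ^ 2 := by
    intro p q a b hp hq
    have h1 : p ^ 2 ≤ (1/20) ^ 2 := sq_le_sq' (abs_le.1 hp).1 (abs_le.1 hp).2
    have h2 : q ^ 2 ≤ (1/20) ^ 2 := sq_le_sq' (abs_le.1 hq).1 (abs_le.1 hq).2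
    have h3 := mul_le_mul_of_nonneg_right h1 (sq_nonneg a)
    have h4 := mul_le_mul_of_nonneg_right h2 (sq_nonneg b)
    nlinarith [sq_nonneg (a + 2 * (p * a - q * b)), sq_nonneg (p * a + q * b)]
  have h1 := h p q a b hp hq
  have h2 := h w r b a hw hr
  nlinarith [sq_nonneg a, sq_nonneg b]

/-- (Uniform positivity of `(b^{kj})`, cf. (5.17)-(5.18).)
If `∫₀ᵗ‖Dv(s)‖_{L^∞} ds ≤ 1/20` then `b^{kj}(x,t) ξ_k ξ_j ≥ |ξ|²/5` for all `x ∈ Ω`,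
`ξ ∈ ℝ²`; in particular `b²²(x,t) ≥ 1/5`. -/
theorem stmt9 (T : ℝ) (v : ℝ → ℝ × ℝ → ℝ × ℝ)
    (hv : ContDiff ℝ 1 (fun p : ℝ × (ℝ × ℝ) => v p.1 p.2)) (hper : PerT v) :
    ∀ t : ℝ, 0 ≤ t → t ≤ T →
      (∫ s in (0:ℝ)..t, dvSup v s) ≤ 1 / 20 →
        ∀ x ∈ Oset,
          (∀ ξ : ℝ × ℝ,
            (ξ.1 ^ 2 + ξ.2 ^ 2) / 5
              ≤ ∑ k : Fin 2, ∑ j : Fin 2,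
                  bmat (flowMap v t) x k j * pick k ξ * pick j ξ) ∧
          1 / 5 ≤ bmat (flowMap v t) x 1 1 := by
  intro t ht _ hI x hx
  have hd := flow_deriv v hv t ht x hx
  set A : (ℝ × ℝ) →L[ℝ] (ℝ × ℝ) := ∫ s in (0:ℝ)..t, fderiv ℝ (v s) x with hA
  have hAn : ‖A‖ ≤ 1 / 20 := by
    have hcd : Continuous (fun s => fderiv ℝ (v s) x) :=
      (cont_dv v hv).comp (Continuous.prodMk_left x)
    refine le_trans (intervalIntegral.norm_integral_le_integral_norm ht) (le_trans ?_ hI)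
    refine intervalIntegral.integral_mono_on ht (hcd.norm.intervalIntegrable _ _)
      (dvSup_integrable v hv t ht) fun s _ => ?_
    exact le_ciSup (dv_bdd v hv s) ⟨x, hx⟩
  have hAe : ∀ e : ℝ × ℝ, ‖e‖ ≤ 1 → |(A e).1| ≤ 1 / 20 ∧ |(A e).2| ≤ 1 / 20 := by
    intro e he
    have h : ‖A e‖ ≤ 1 / 20 :=
      (A.le_opNorm e).trans (by nlinarith [norm_nonneg A, norm_nonneg e])
    exact ⟨(norm_fst_le (A e)).trans h, (norm_snd_le (A e)).trans h⟩
  have h1 := hAe (1, 0) (by simp [Prod.norm_def])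
  have h2 := hAe (0, 1) (by simp [Prod.norm_def])
  have f1 : fderiv ℝ (fun y => (flowMap v t y).1) x = _ := hd.fst.fderiv
  have f2 : fderiv ℝ (fun y => (flowMap v t y).2) x = _ := hd.snd.fderiv
  have key : ∀ ξ : ℝ × ℝ, (ξ.1 ^ 2 + ξ.2 ^ 2) / 5
      ≤ ∑ k : Fin 2, ∑ j : Fin 2, bmat (flowMap v t) x k j * pick k ξ * pick j ξ := by
    intro ξ
    have := quad_bound (A (0, 1)).2 (A (1, 0)).2 (A (0, 1)).1 (A (1, 0)).1 ξ.1 ξ.2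
      h2.2 h1.2 h2.1 h1.1
    refine this.trans (le_of_eq ?_)
    simp [Fin.sum_univ_two, bmat, cof, pick, pd1, pd2, f1, f2]
    ring
  refine ⟨key, ?_⟩
  have := key (0, 1)
  simpa [Fin.sum_univ_two, pick] using this
end
end
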